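/- arXiv:0902.0973 — 9 statements merged into one kernel-verified Lean document; each statement's English description precedes it below -/
import Mathlib

section
/- Let r₀ > 0 and let ψ : [r₀, ∞) → ℝ be continuously differentiable. Assume there exists δ > 0 with lim_{r→∞} r^(3/2+δ) ψ(r) = 0, and that ∫_{r₀}^∞ (ψ'(r))² (r³ − r₀³)²/r² dr < ∞. Then ∫_{r₀}^∞ ψ(r)² r² dr ≤ (4/9) ∫_{r₀}^∞ (ψ'(r))² (r³ − r₀³)²/r² dr. -/
open MeasureTheory Set Filter

/-- A function decaying like `r^(−3/2−δ)` satisfies `ψ² (r³ − r₀³) → 0`. -/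
lemma tendsto_sq_mul_cube_sub_of_decay {r₀ δ : ℝ} (hr₀ : 0 < r₀) (hδ : 0 < δ) {ψ : ℝ → ℝ}
    (h : Tendsto (fun r : ℝ => r ^ ((3 : ℝ) / 2 + δ) * ψ r) atTop (nhds 0)) :
    Tendsto (fun r => ψ r ^ 2 * (r ^ 3 - r₀ ^ 3)) atTop (nhds 0) := by
  have h2 : Tendsto (fun r : ℝ => (r ^ ((3 : ℝ) / 2 + δ) * ψ r) ^ 2) atTop (nhds 0) := by
    simpa using h.pow 2
  refine tendsto_of_tendsto_of_tendsto_of_le_of_le' tendsto_const_nhds h2 ?_ ?_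
  · filter_upwards [eventually_ge_atTop r₀] with r hr
    have : r₀ ^ 3 ≤ r ^ 3 := by gcongr
    exact mul_nonneg (sq_nonneg _) (sub_nonneg.2 this)
  · filter_upwards [eventually_ge_atTop 1] with r hr
    have hpow : r ^ 3 ≤ (r ^ ((3 : ℝ) / 2 + δ)) ^ 2 := by
      rw [← Real.rpow_natCast, ← Real.rpow_natCast, ← Real.rpow_mul (by linarith)]
      apply Real.rpow_le_rpow_of_exponent_le hr
      push_cast
      linarith
    have : 0 < r₀ ^ 3 := by positivity
    rw [mul_pow, mul_comm]
    gcongr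
    linarith

/-- Hardy inequality on `[r₀, ∞)`: if `ψ` is `C¹`, decays like `r^(−3/2−δ)` at infinity,
and the right-hand side is finite, then
`∫_{r₀}^∞ ψ² r² dr ≤ (4/9) ∫_{r₀}^∞ (ψ')² (r³ − r₀³)²/r² dr`. -/
theorem hardy_inequality_schwarzschild_ads (r₀ : ℝ) (hr₀ : 0 < r₀) (ψ ψ' : ℝ → ℝ)
    (hderiv : ∀ r ∈ Ici r₀, HasDerivAt ψ (ψ' r) r)
    (hcont : ContinuousOn ψ' (Ici r₀))
    (hdec : ∃ δ : ℝ, 0 < δ ∧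
      Tendsto (fun r : ℝ => r ^ ((3 : ℝ) / 2 + δ) * ψ r) atTop (nhds 0))
    (hint : IntegrableOn
      (fun r => (ψ' r) ^ 2 * (r ^ 3 - r₀ ^ 3) ^ 2 / r ^ 2) (Ioi r₀)) :
    ∫ r in Ioi r₀, (ψ r) ^ 2 * r ^ 2 ≤
      (4 / 9) * ∫ r in Ioi r₀, (ψ' r) ^ 2 * (r ^ 3 - r₀ ^ 3) ^ 2 / r ^ 2 := by
  obtain ⟨δ, hδ, hlim⟩ := hdec
  by_cases hI : IntegrableOn (fun r => (ψ r) ^ 2 * r ^ 2) (Ioi r₀)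
  swap
  · rw [integral_undef hI]
    have : 0 ≤ ∫ r in Ioi r₀, (ψ' r) ^ 2 * (r ^ 3 - r₀ ^ 3) ^ 2 / r ^ 2 :=
      integral_nonneg fun r => by positivity
    positivity
  set F' : ℝ → ℝ := fun r =>
    2 * ψ r * ψ' r * (r ^ 3 - r₀ ^ 3) + ψ r ^ 2 * (3 * r ^ 2) with hF'
  have hF : ∀ r ∈ Ici r₀, HasDerivAt (fun r => ψ r ^ 2 * (r ^ 3 - r₀ ^ 3)) (F' r) r := by
    intro r hr
    refine (((hderiv r hr).pow 2).mul ((hasDerivAt_pow 3 r).sub_const (r₀ ^ 3))).congr_deriv ?_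
    simp [hF']
  have hψ : ContinuousOn ψ (Ici r₀) := fun r hr => (hderiv r hr).continuousAt.continuousWithinAt
  have hFcont : ContinuousOn F' (Ici r₀) := by fun_prop
  have hFint : IntegrableOn F' (Ioi r₀) := by
    refine Integrable.mono' ((hI.const_mul 4).add hint)
      ((hFcont.mono Ioi_subset_Ici_self).aestronglyMeasurable measurableSet_Ioi) ?_
    filter_upwards [ae_restrict_mem measurableSet_Ioi] with r hr
    have hr' : r ≠ 0 := (hr₀.trans hr).ne'
    have e : ψ' r * (r ^ 3 - r₀ ^ 3) = r * (ψ' r * (r ^ 3 - r₀ ^ 3) / r) := by field_simp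
    have e1 : F' r = 2 * (ψ r * r) * (ψ' r * (r ^ 3 - r₀ ^ 3) / r) + 3 * (ψ r * r) ^ 2 := by
      simp only [hF']; linear_combination 2 * ψ r * e
    have e2 : ψ' r ^ 2 * (r ^ 3 - r₀ ^ 3) ^ 2 / r ^ 2 = (ψ' r * (r ^ 3 - r₀ ^ 3) / r) ^ 2 := by
      ring
    simp only [Pi.add_apply, Real.norm_eq_abs, e1, e2]
    rw [← mul_pow, abs_le]
    constructor <;> nlinarith [sq_nonneg (ψ r * r + ψ' r * (r ^ 3 - r₀ ^ 3) / r),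
      sq_nonneg (ψ r * r - ψ' r * (r ^ 3 - r₀ ^ 3) / r), sq_nonneg (ψ r * r)]
  have hzero : ∫ r in Ioi r₀, F' r = 0 := by
    rw [integral_Ioi_of_hasDerivAt_of_tendsto' hF hFint
      (tendsto_sq_mul_cube_sub_of_decay hr₀ hδ hlim)]
    simp
  calc ∫ r in Ioi r₀, (ψ r) ^ 2 * r ^ 2
      ≤ ∫ r in Ioi r₀, ((4 / 9) * ((ψ' r) ^ 2 * (r ^ 3 - r₀ ^ 3) ^ 2 / r ^ 2)
          + (2 / 3) * F' r) := by
        refine setIntegral_mono_on hI ((hint.const_mul _).add (hFint.const_mul _))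
          measurableSet_Ioi fun r hr => ?_
        have hr' : r ≠ 0 := (hr₀.trans hr).ne'
        have key : (4 / 9) * ((ψ' r) ^ 2 * (r ^ 3 - r₀ ^ 3) ^ 2 / r ^ 2) + (2 / 3) * F' r
            - (ψ r) ^ 2 * r ^ 2
            = (ψ r * r + 2 / 3 * (ψ' r * (r ^ 3 - r₀ ^ 3) / r)) ^ 2 := by
          simp only [hF']
          field_simp
          ring
        linarith [sq_nonneg (ψ r * r + 2 / 3 * (ψ' r * (r ^ 3 - r₀ ^ 3) / r))]
    _ = (4 / 9) * ∫ r in Ioi r₀, (ψ' r) ^ 2 * (r ^ 3 - r₀ ^ 3) ^ 2 / r ^ 2 := by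
        rw [integral_add (hint.const_mul _) (hFint.const_mul _), integral_const_mul,
          integral_const_mul, hzero, mul_zero, add_zero]
end

section
/- Let M > 0, l > 0, let r_hoz > 0 satisfy r_hoz³ + l²r_hoz − 2Ml² = 0, and let α ≥ 0. Let ψ : [r_hoz, ∞) → ℝ be continuously differentiable with lim_{r→∞} r^(3/2+δ) ψ(r) = 0 for some δ > 0 and with ∫_{r_hoz}^∞ (ψ'(r))² r² (1 − 2M/r + r²/l²) dr < ∞. Then (α/l²) ∫_{r_hoz}^∞ ψ(r)² r² dr ≤ (4α/9) ∫_{r_hoz}^∞ (ψ'(r))² r² (1 − 2M/r + r²/l²) dr. -/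
open MeasureTheory Set Filter

lemma sq_mul_sq_le_deriv_add_weight {a l r y y' m : ℝ} (ha : 0 < a) (hl : 0 < l)
    (hroot : a ^ 3 + l ^ 2 * a - 2 * m * l ^ 2 = 0) (har : a ≤ r) :
    y ^ 2 * r ^ 2 ≤ 2 * (r ^ 2 * y ^ 2 + (r ^ 3 - a ^ 3) / 3 * (2 * y * y')) +
      4 * l ^ 2 / 9 * (y' ^ 2 * r ^ 2 * (1 - 2 * m / r + r ^ 2 / l ^ 2)) := by
  have hr : 0 < r := ha.trans_le har
  have hcube : a ^ 3 ≤ r ^ 3 := by gcongr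
  have hweight : l ^ 2 * (r ^ 2 * (1 - 2 * m / r + r ^ 2 / l ^ 2)) =
      r * (l ^ 2 * (r - a) + (r ^ 3 - a ^ 3)) := by
    field_simp
    linear_combination hroot
  have hbound : ((r ^ 3 - a ^ 3) / r) ^ 2 ≤ r * (l ^ 2 * (r - a) + (r ^ 3 - a ^ 3)) := by
    rw [div_pow, div_le_iff₀ (by positivity)]
    have h₁ : 0 ≤ r ^ 3 * (l ^ 2 * (r - a)) :=
      mul_nonneg (by positivity) (mul_nonneg (by positivity) (sub_nonneg.2 har))
    have h₂ : 0 ≤ a ^ 3 * (r ^ 3 - a ^ 3) :=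
      mul_nonneg (by positivity) (sub_nonneg.2 hcube)
    nlinarith
  have hsq : (r * y + 2 / 3 * ((r ^ 3 - a ^ 3) / r) * y') ^ 2 =
      r ^ 2 * y ^ 2 + 4 / 3 * (r ^ 3 - a ^ 3) * y * y' +
        4 / 9 * (((r ^ 3 - a ^ 3) / r) ^ 2 * y' ^ 2) := by
    field_simp
    ring
  have hmul := mul_le_mul_of_nonneg_right (hbound.trans_eq hweight.symm) (sq_nonneg y')
  linarith [sq_nonneg (r * y + 2 / 3 * ((r ^ 3 - a ^ 3) / r) * y')]

lemma tendsto_cube_sub_mul_sq_atTop {a δ : ℝ} {f : ℝ → ℝ} (hδ : 0 < δ)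
    (hf : Tendsto (fun r : ℝ => r ^ ((3 : ℝ) / 2 + δ) * f r) atTop (nhds 0)) (ha : 0 < a) :
    Tendsto (fun r : ℝ => (r ^ 3 - a ^ 3) / 3 * f r ^ 2) atTop (nhds 0) := by
  have hf2 : Tendsto (fun r : ℝ => (r ^ ((3 : ℝ) / 2 + δ) * f r) ^ 2) atTop (nhds 0) := by
    simpa using hf.pow 2
  refine squeeze_zero' ?_ ?_ hf2
  · filter_upwards [eventually_ge_atTop a] with r hr
    have : a ^ 3 ≤ r ^ 3 := by gcongr
    exact mul_nonneg (by linarith) (sq_nonneg _)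
  · filter_upwards [eventually_ge_atTop 1] with r hr
    have hr0 : 0 < r := by linarith
    have hpow : r ^ 3 ≤ (r ^ ((3 : ℝ) / 2 + δ)) ^ 2 := by
      rw [← Real.rpow_natCast, ← Real.rpow_natCast, ← Real.rpow_mul hr0.le]
      exact Real.rpow_le_rpow_of_exponent_le hr (by push_cast; linarith)
    rw [mul_pow]
    refine mul_le_mul_of_nonneg_right ?_ (sq_nonneg _)
    have : 0 < a ^ 3 := by positivity
    have : 0 < r ^ 3 := by positivity
    linarith

/-- Hardy inequality with the Schwarzschild-AdS weight: for `α ≥ 0` and `ψ` a `C¹`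
function decaying like `r^(−3/2−δ)` at infinity,
`(α/l²) ∫_{r_hoz}^∞ ψ² r² dr ≤ (4α/9) ∫_{r_hoz}^∞ (ψ')² r² (1 − 2M/r + r²/l²) dr`. -/
theorem hardy_inequality_schwarzschild_ads_weighted (M l r_hoz α : ℝ)
    (hM : 0 < M) (hl : 0 < l) (hrh : 0 < r_hoz)
    (hroot : r_hoz ^ 3 + l ^ 2 * r_hoz - 2 * M * l ^ 2 = 0)
    (hα : 0 ≤ α) (ψ ψ' : ℝ → ℝ)
    (hderiv : ∀ r ∈ Ici r_hoz, HasDerivAt ψ (ψ' r) r)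
    (hcont : ContinuousOn ψ' (Ici r_hoz))
    (hdec : ∃ δ : ℝ, 0 < δ ∧
      Tendsto (fun r : ℝ => r ^ ((3 : ℝ) / 2 + δ) * ψ r) atTop (nhds 0))
    (hint : IntegrableOn
      (fun r => (ψ' r) ^ 2 * r ^ 2 * (1 - 2 * M / r + r ^ 2 / l ^ 2)) (Ioi r_hoz)) :
    (α / l ^ 2) * ∫ r in Ioi r_hoz, (ψ r) ^ 2 * r ^ 2 ≤
      (4 * α / 9) *
        ∫ r in Ioi r_hoz, (ψ' r) ^ 2 * r ^ 2 * (1 - 2 * M / r + r ^ 2 / l ^ 2) := by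
  obtain ⟨δ, hδ, hlim⟩ := hdec
  set w : ℝ → ℝ := fun r => (ψ' r) ^ 2 * r ^ 2 * (1 - 2 * M / r + r ^ 2 / l ^ 2)
  suffices h : ∫ r in Ioi r_hoz, (ψ r) ^ 2 * r ^ 2 ≤ 4 * l ^ 2 / 9 * ∫ r in Ioi r_hoz, w r by
    calc (α / l ^ 2) * ∫ r in Ioi r_hoz, (ψ r) ^ 2 * r ^ 2
        ≤ (α / l ^ 2) * (4 * l ^ 2 / 9 * ∫ r in Ioi r_hoz, w r) := by gcongr
      _ = (4 * α / 9) * ∫ r in Ioi r_hoz, w r := by field_simp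
  by_cases hψint : IntegrableOn (fun r => (ψ r) ^ 2 * r ^ 2) (Ioi r_hoz)
  swap
  · rw [integral_undef hψint]
    refine mul_nonneg (by positivity) (setIntegral_nonneg measurableSet_Ioi fun r hr => ?_)
    have h := sq_mul_sq_le_deriv_add_weight (y := 0) (y' := ψ' r) hrh hl hroot (le_of_lt hr)
    have hc : 0 < 4 * l ^ 2 / 9 := by positivity
    refine nonneg_of_mul_nonneg_right ?_ hc
    simpa using h
  have hfinite : ∀ᶠ R in atTop, ∫ r in r_hoz..R, (ψ r) ^ 2 * r ^ 2 ≤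
      2 * ((R ^ 3 - r_hoz ^ 3) / 3 * ψ R ^ 2) + 4 * l ^ 2 / 9 * ∫ r in r_hoz..R, w r := by
    filter_upwards [eventually_ge_atTop r_hoz] with R hR
    have hsub : uIcc r_hoz R ⊆ Ici r_hoz := by
      rw [uIcc_of_le hR]
      exact Icc_subset_Ici_self
    have hψc : ContinuousOn ψ (uIcc r_hoz R) := fun r hr =>
      (hderiv r (hsub hr)).continuousAt.continuousWithinAt
    have hψ'c : ContinuousOn ψ' (uIcc r_hoz R) := hcont.mono hsub
    have hDint : IntervalIntegrable (fun r => r ^ 2 * ψ r ^ 2 +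
        (r ^ 3 - r_hoz ^ 3) / 3 * (2 * ψ r * ψ' r)) volume r_hoz R :=
      ContinuousOn.intervalIntegrable (by fun_prop)
    have hwint : IntervalIntegrable w volume r_hoz R :=
      (intervalIntegrable_iff_integrableOn_Ioc_of_le hR).2 (hint.mono_set Ioc_subset_Ioi_self)
    have hftc := intervalIntegral.integral_eq_sub_of_hasDerivAt
      (f := fun r => (r ^ 3 - r_hoz ^ 3) / 3 * ψ r ^ 2) (fun r hr => by
        have hF := ((hasDerivAt_pow 3 r).sub_const (r_hoz ^ 3)).div_const 3
        refine (hF.mul ((hderiv r (hsub hr)).pow 2)).congr_deriv ?_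
        simp) hDint
    have hmono := intervalIntegral.integral_mono_on hR
      (ContinuousOn.intervalIntegrable (by fun_prop))
      ((hDint.const_mul 2).add (hwint.const_mul (4 * l ^ 2 / 9)))
      (fun r hr => sq_mul_sq_le_deriv_add_weight (y := ψ r) (y' := ψ' r) hrh hl hroot hr.1)
    refine hmono.trans_eq ?_
    rw [intervalIntegral.integral_add (hDint.const_mul 2) (hwint.const_mul _),
      intervalIntegral.integral_const_mul, intervalIntegral.integral_const_mul, hftc]
    simp
  have hboundary := (tendsto_cube_sub_mul_sq_atTop hδ hlim hrh).const_mul 2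
  have hright := hboundary.add
    ((intervalIntegral_tendsto_integral_Ioi r_hoz hint tendsto_id).const_mul (4 * l ^ 2 / 9))
  rw [mul_zero, zero_add] at hright
  exact le_of_tendsto_of_tendsto
    (intervalIntegral_tendsto_integral_Ioi r_hoz hψint tendsto_id) hright hfinite
end

section
/- Let r₁ > 0 and let ψ : [r₁, ∞) → ℝ be continuously differentiable with lim_{s→∞} ψ(s) = 0 and ∫_{r₁}^∞ (ψ'(s))² s⁴ ds < ∞. Then for every r ≥ r₁, |ψ(r)| ≤ (1/(√3 · r^(3/2))) · ( ∫_r^∞ (ψ'(s))² s⁴ ds )^(1/2). -/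
open MeasureTheory Set Filter

/-- Cauchy–Schwarz inequality for real functions, with square roots. -/
theorem abs_integral_mul_le_sqrt_mul_sqrt {α : Type*} [MeasurableSpace α] {μ : Measure α}
    {f g : α → ℝ} (hf : MemLp f 2 μ) (hg : MemLp g 2 μ) :
    |∫ a, f a * g a ∂μ| ≤ Real.sqrt (∫ a, f a ^ 2 ∂μ) * Real.sqrt (∫ a, g a ^ 2 ∂μ) := by
  have h := integral_mul_le_Lp_mul_Lq_of_nonneg (μ := μ) (p := 2) (q := 2) (f := fun a => |f a|)
    (g := fun a => |g a|) Real.HolderConjugate.two_two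
    (ae_of_all _ fun a => abs_nonneg _) (ae_of_all _ fun a => abs_nonneg _)
    (by rw [ENNReal.ofReal_ofNat]; exact hf.abs) (by rw [ENNReal.ofReal_ofNat]; exact hg.abs)
  simp only [Real.rpow_two, sq_abs, ← Real.sqrt_eq_rpow, ← abs_mul] at h
  exact (abs_integral_le_integral_abs).trans h

theorem eqOn_rpow_neg_four_inv_sq_sq {r : ℝ} (hr : 0 < r) :
    EqOn (fun s : ℝ => s ^ (-4 : ℝ)) (fun s => ((s ^ 2)⁻¹) ^ 2) (Ioi r) := fun s hs => by
  dsimp only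
  rw [Real.rpow_neg (hr.trans hs).le, inv_pow, ← pow_mul]
  norm_cast

theorem integrableOn_Ioi_inv_sq_sq {r : ℝ} (hr : 0 < r) :
    IntegrableOn (fun s : ℝ => ((s ^ 2)⁻¹) ^ 2) (Ioi r) :=
  (integrableOn_Ioi_rpow_of_lt (by norm_num) hr).congr_fun (eqOn_rpow_neg_four_inv_sq_sq hr)
    measurableSet_Ioi

theorem integral_Ioi_inv_sq_sq {r : ℝ} (hr : 0 < r) :
    ∫ s in Ioi r, ((s ^ 2)⁻¹) ^ 2 = 1 / (3 * r ^ 3) := by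
  rw [← setIntegral_congr_fun measurableSet_Ioi (eqOn_rpow_neg_four_inv_sq_sq hr),
    integral_Ioi_rpow_of_lt (by norm_num) hr, show (-4 : ℝ) + 1 = -3 by norm_num,
    Real.rpow_neg hr.le, show r ^ (3 : ℝ) = r ^ 3 by norm_cast]
  field_simp

theorem sqrt_one_div_three_mul_pow_three {r : ℝ} (hr : 0 < r) :
    Real.sqrt (1 / (3 * r ^ 3)) = 1 / (Real.sqrt 3 * r ^ ((3 : ℝ) / 2)) := by
  rw [Real.sqrt_div zero_le_one, Real.sqrt_one, Real.sqrt_mul (by norm_num),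
    Real.sqrt_eq_rpow (r ^ 3), ← Real.rpow_natCast, ← Real.rpow_mul hr.le]
  norm_num

/-- Radial pointwise bound: if `ψ` is `C¹` on `[r₁, ∞)`, tends to `0` at infinity,
and `∫_{r₁}^∞ (ψ')² s⁴ ds < ∞`, then for every `r ≥ r₁`,
`|ψ(r)| ≤ (1/(√3 · r^(3/2))) (∫_r^∞ (ψ')² s⁴ ds)^{1/2}`. -/
theorem pointwise_radial_decay_bound (r₁ : ℝ) (hr₁ : 0 < r₁) (ψ ψ' : ℝ → ℝ)
    (hderiv : ∀ s ∈ Ici r₁, HasDerivAt ψ (ψ' s) s)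
    (hcont : ContinuousOn ψ' (Ici r₁))
    (hlim : Tendsto ψ atTop (nhds 0))
    (hint : IntegrableOn (fun s => (ψ' s) ^ 2 * s ^ 4) (Ioi r₁)) :
    ∀ r : ℝ, r₁ ≤ r →
      |ψ r| ≤ (1 / (Real.sqrt 3 * r ^ ((3 : ℝ) / 2))) *
        Real.sqrt (∫ s in Ioi r, (ψ' s) ^ 2 * s ^ 4) := by
  intro r hr
  have hr0 : 0 < r := hr₁.trans_le hr
  have hsub : Ioi r ⊆ Ici r₁ := fun s hs => hr.trans (le_of_lt hs)
  have hf : MemLp (fun s => ψ' s * s ^ 2) 2 (volume.restrict (Ioi r)) := by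
    refine (memLp_two_iff_integrable_sq ?_).2 ?_
    · exact ((hcont.mono hsub).mul (continuous_pow 2).continuousOn).aestronglyMeasurable
        measurableSet_Ioi
    · refine (hint.mono_set (Ioi_subset_Ioi hr)).congr (ae_of_all _ fun s => ?_)
      ring
  have hg : MemLp (fun s : ℝ => (s ^ 2)⁻¹) 2 (volume.restrict (Ioi r)) :=
    (memLp_two_iff_integrable_sq (by fun_prop)).2 (integrableOn_Ioi_inv_sq_sq hr0)
  have hfg : EqOn (fun s => ψ' s * s ^ 2 * (s ^ 2)⁻¹) ψ' (Ioi r) := fun s hs =>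
    mul_inv_cancel_right₀ (pow_ne_zero 2 (hr0.trans hs).ne') _
  have hψ' : IntegrableOn ψ' (Ioi r) :=
    IntegrableOn.congr_fun (hf.integrable_mul hg) hfg measurableSet_Ioi
  have hftc : ∫ s in Ioi r, ψ' s = 0 - ψ r :=
    integral_Ioi_of_hasDerivAt_of_tendsto' (fun s hs => hderiv s (hr.trans hs)) hψ' hlim
  have hCS := abs_integral_mul_le_sqrt_mul_sqrt hf hg
  rw [setIntegral_congr_fun measurableSet_Ioi hfg, hftc, zero_sub, abs_neg,
    integral_Ioi_inv_sq_sq hr0, sqrt_one_div_three_mul_pow_three hr0, mul_comm] at hCS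
  simpa only [mul_pow, ← pow_mul] using hCS
end

section
/- Let M be real, l > 0, a ≠ 0 (or a = 0 and the identity restricted to r ≠ 0), and set Δ₋(r) = (r² + a²)(1 + r²/l²) − 2Mr. Let r_h > 0 satisfy Δ₋(r_h) = 0, and define f(r) = (1/((r² + a²)l²))·(r − r_h)·[ r³(l² − 4a²) + r²(r_h³ − a²l²/r_h + a²r_h) + r(r_h⁴ − 8a⁴ + a²(r_h² + l²)) + r_h(r_h² + 3a²)² − a⁴l²/r_h ]. Then for every real r (with r² + a² ≠ 0), Δ₋(r) − (r³ − r_h³ + 3a²(r − r_h))² / ((r² + a²)l²) = f(r). -/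
/-- Second identity of Lemma 5.1: with `Δ₋(r) = (r² + a²)(1 + r²/l²) − 2Mr` and
`r_h > 0` a root of `Δ₋`, the deficit between `Δ₋` and the Hardy square is the
explicit function `f`. -/
theorem kerr_ads_delta_minus_deficit (M a l r_h : ℝ) (hl : 0 < l)
    (hrh : 0 < r_h)
    (hroot : (r_h ^ 2 + a ^ 2) * (1 + r_h ^ 2 / l ^ 2) - 2 * M * r_h = 0) :
    ∀ r : ℝ, r ^ 2 + a ^ 2 ≠ 0 →
      ((r ^ 2 + a ^ 2) * (1 + r ^ 2 / l ^ 2) - 2 * M * r) -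
          (r ^ 3 - r_h ^ 3 + 3 * a ^ 2 * (r - r_h)) ^ 2 / ((r ^ 2 + a ^ 2) * l ^ 2) =
        (1 / ((r ^ 2 + a ^ 2) * l ^ 2)) * (r - r_h) *
          (r ^ 3 * (l ^ 2 - 4 * a ^ 2) +
            r ^ 2 * (r_h ^ 3 - a ^ 2 * l ^ 2 / r_h + a ^ 2 * r_h) +
            r * (r_h ^ 4 - 8 * a ^ 4 + a ^ 2 * (r_h ^ 2 + l ^ 2)) +
            r_h * (r_h ^ 2 + 3 * a ^ 2) ^ 2 - a ^ 4 * l ^ 2 / r_h) := by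
  intro r hr
  have hM : M = (r_h ^ 2 + a ^ 2) * (1 + r_h ^ 2 / l ^ 2) / (2 * r_h) := by
    rw [eq_div_iff (by positivity)]
    linarith
  subst hM
  field_simp
  ring
end

section
/- Let M be real, l > 0, a > 0 with a < l/2, let r_h > 0 satisfy Δ₋(r_h) = 0 and a·l < r_h², and define f(r) = (1/((r² + a²)l²))·(r − r_h)·[ r³(l² − 4a²) + r²(r_h³ − a²l²/r_h + a²r_h) + r(r_h⁴ − 8a⁴ + a²(r_h² + l²)) + r_h(r_h² + 3a²)² − a⁴l²/r_h ]. Then f(r) ≥ 0 for all r ≥ r_h. -/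
/-- Nonnegativity of the deficit function `f` outside the horizon for slowly
rotating Kerr-AdS: if `0 < a < l/2`, `r_h > 0` satisfies `Δ₋(r_h) = 0` and
`a·l < r_h²`, then `f(r) ≥ 0` for all `r ≥ r_h`. -/
theorem kerr_ads_deficit_nonneg (M a l r_h : ℝ) (hl : 0 < l)
    (ha : 0 < a) (hal : a < l / 2)
    (hrh : 0 < r_h)
    (hroot : (r_h ^ 2 + a ^ 2) * (1 + r_h ^ 2 / l ^ 2) - 2 * M * r_h = 0)
    (hslow : a * l < r_h ^ 2) :
    ∀ r : ℝ, r_h ≤ r →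
      0 ≤ (1 / ((r ^ 2 + a ^ 2) * l ^ 2)) * (r - r_h) *
        (r ^ 3 * (l ^ 2 - 4 * a ^ 2) +
          r ^ 2 * (r_h ^ 3 - a ^ 2 * l ^ 2 / r_h + a ^ 2 * r_h) +
          r * (r_h ^ 4 - 8 * a ^ 4 + a ^ 2 * (r_h ^ 2 + l ^ 2)) +
          r_h * (r_h ^ 2 + 3 * a ^ 2) ^ 2 - a ^ 4 * l ^ 2 / r_h) := by
  intro r hr
  have hr0 : 0 < r := hrh.trans_le hr
  have hl2 : 4 * a ^ 2 < l ^ 2 := by nlinarith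
  have hrh2 : 2 * a ^ 2 < r_h ^ 2 := by nlinarith
  have hrh4 : a ^ 2 * l ^ 2 < r_h ^ 4 := by
    have h := pow_lt_pow_left₀ hslow (by positivity) two_ne_zero
    linarith [mul_pow a l 2, pow_mul r_h 2 2]
  have hquot : a ^ 2 * l ^ 2 / r_h < r_h ^ 3 := by
    rw [div_lt_iff₀ hrh]
    linarith [pow_succ r_h 3]
  have hcubic : 0 ≤ l ^ 2 - 4 * a ^ 2 := by linarith
  have hquadratic : 0 ≤ r_h ^ 3 - a ^ 2 * l ^ 2 / r_h + a ^ 2 * r_h := by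
    have : 0 < a ^ 2 * r_h := by positivity
    linarith
  have hlinear : 0 ≤ r_h ^ 4 - 8 * a ^ 4 + a ^ 2 * (r_h ^ 2 + l ^ 2) := by
    have h₁ := mul_lt_mul_of_pos_left hl2 (pow_pos ha 2)
    have h₂ := mul_lt_mul_of_pos_left hrh2 (pow_pos ha 2)
    have : 0 < a ^ 4 := by positivity
    linarith
  have hconst : 0 ≤ r_h * (r_h ^ 2 + 3 * a ^ 2) ^ 2 - a ^ 4 * l ^ 2 / r_h := by
    have h := mul_lt_mul_of_pos_left hquot (pow_pos ha 2)
    have hsplit : a ^ 4 * l ^ 2 / r_h = a ^ 2 * (a ^ 2 * l ^ 2 / r_h) := by ring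
    have hpos : 0 < r_h ^ 5 + 5 * a ^ 2 * r_h ^ 3 + 9 * a ^ 4 * r_h := by positivity
    rw [hsplit]
    linarith
  have hprefactor : 0 ≤ 1 / ((r ^ 2 + a ^ 2) * l ^ 2) * (r - r_h) :=
    mul_nonneg (by positivity) (sub_nonneg.2 hr)
  refine mul_nonneg hprefactor ?_
  have h₃ := mul_nonneg (pow_pos hr0 3).le hcubic
  have h₂ := mul_nonneg (pow_pos hr0 2).le hquadratic
  have h₁ := mul_nonneg hr0.le hlinear
  linarith
end

section
/- Let M > 0 and l > 0. There exists a₀ > 0, depending only on M and l, such that for every a with 0 < a < a₀ and every r_h > 0 satisfying Δ₋(r_h) = 0 and a·l < r_h², the following holds for all r ≥ r_h and all θ ∈ [0, π]: 16·Δ_θ·sin²θ · a²(r − r_h)²(r − l²/r_h)² / (k₀² l⁴) ≤ f(r), where k₀ = 1 + r²/l², Δ_θ = 1 − (a²/l²)cos²θ, and f(r) = (1/((r² + a²)l²))·(r − r_h)·[ r³(l² − 4a²) + r²(r_h³ − a²l²/r_h + a²r_h) + r(r_h⁴ − 8a⁴ + a²(r_h² + l²)) + r_h(r_h² + 3a²)²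 − a⁴l²/r_h ]. -/
/-- A horizon radius with `a * l < h ^ 2` is bounded below independently of `a`. -/
lemma min_le_horizon_radius {M l a h : ℝ} (hl : 0 < l) (ha : 0 < a) (hh : 0 < h)
    (hΔ : (h ^ 2 + a ^ 2) * (1 + h ^ 2 / l ^ 2) - 2 * M * h = 0) (hal : a * l < h ^ 2) :
    min l (M / 2) ≤ h := by
  by_contra! hlt
  obtain ⟨h1, h2⟩ := lt_min_iff.1 hlt
  have ht : h ^ 2 / l ^ 2 ≤ 1 := by
    rw [div_le_one (by positivity)]
    gcongr
  have hah : a < h := by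
    nlinarith
  have hprod : (h ^ 2 + a ^ 2) * (1 + h ^ 2 / l ^ 2) ≤ (h ^ 2 + h ^ 2) * (1 + 1) := by
    gcongr
  nlinarith

/-- The cubic factor of the radial weight dominates the cross term when `a` is small. -/
lemma cross_term_le_cubic {l a h r : ℝ} (hl : 0 < l) (ha : 0 < a) (hh : 0 < h) (hr : h ≤ r)
    (hah : a ≤ h / 8) (hal : a ≤ l / 8) (hahl : a * l ≤ h ^ 2 / 8) :
    16 * a ^ 2 * r * (l ^ 2 + l ^ 4 / h ^ 2) ≤
      r ^ 3 * (l ^ 2 - 4 * a ^ 2) +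
        r ^ 2 * (h ^ 3 - a ^ 2 * l ^ 2 / h + a ^ 2 * h) +
        r * (h ^ 4 - 8 * a ^ 4 + a ^ 2 * (h ^ 2 + l ^ 2)) +
        h * (h ^ 2 + 3 * a ^ 2) ^ 2 - a ^ 4 * l ^ 2 / h := by
  have hr0 : 0 < r := hh.trans_le hr
  have e1 : 16 * a ^ 2 * r * (l ^ 4 / h ^ 2) ≤ l ^ 2 * r ^ 3 / 4 := by
    calc 16 * a ^ 2 * r * (l ^ 4 / h ^ 2) = 16 * (a * l) ^ 2 * l ^ 2 * r / h ^ 2 := by ring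
      _ ≤ 16 * (h ^ 2 / 8) ^ 2 * l ^ 2 * r / h ^ 2 := by gcongr
      _ = l ^ 2 * r * h ^ 2 / 4 := by field_simp; ring
      _ ≤ l ^ 2 * r * r ^ 2 / 4 := by gcongr
      _ = l ^ 2 * r ^ 3 / 4 := by ring
  have e2 : 16 * a ^ 2 * r * l ^ 2 ≤ l ^ 2 * r ^ 3 / 4 := by
    calc 16 * a ^ 2 * r * l ^ 2 ≤ 16 * (r / 8) ^ 2 * r * l ^ 2 := by gcongr; linarith
      _ = l ^ 2 * r ^ 3 / 4 := by ring
  have e3 : r ^ 2 * (a ^ 2 * l ^ 2 / h) ≤ l ^ 2 * r ^ 3 / 64 := by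
    calc r ^ 2 * (a ^ 2 * l ^ 2 / h) ≤ r ^ 2 * ((h / 8) ^ 2 * l ^ 2 / h) := by gcongr
      _ = r ^ 2 * l ^ 2 * h / 64 := by field_simp; ring
      _ ≤ r ^ 2 * l ^ 2 * r / 64 := by gcongr
      _ = l ^ 2 * r ^ 3 / 64 := by ring
  have e4 : r * (8 * a ^ 4) ≤ l ^ 2 * r ^ 3 / 512 := by
    calc r * (8 * a ^ 4) = r * (8 * (a ^ 2 * a ^ 2)) := by ring
      _ ≤ r * (8 * ((l / 8) ^ 2 * (r / 8) ^ 2)) := by gcongr; linarith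
      _ = l ^ 2 * r ^ 3 / 512 := by ring
  have e5 : a ^ 4 * l ^ 2 / h ≤ l ^ 2 * r ^ 3 / 4096 := by
    calc a ^ 4 * l ^ 2 / h ≤ (h / 8) ^ 4 * l ^ 2 / h := by gcongr
      _ = h ^ 3 * l ^ 2 / 4096 := by field_simp; ring
      _ ≤ r ^ 3 * l ^ 2 / 4096 := by gcongr
      _ = l ^ 2 * r ^ 3 / 4096 := by ring
  have e6 : r ^ 3 * (4 * a ^ 2) ≤ l ^ 2 * r ^ 3 / 16 := by
    calc r ^ 3 * (4 * a ^ 2) ≤ r ^ 3 * (4 * (l / 8) ^ 2) := by gcongr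
      _ = l ^ 2 * r ^ 3 / 16 := by ring
  have p0 : 0 < l ^ 2 * r ^ 3 := by positivity
  have p1 : 0 < r ^ 2 * (h ^ 3 + a ^ 2 * h) := by positivity
  have p2 : 0 < r * (h ^ 4 + a ^ 2 * (h ^ 2 + l ^ 2)) := by positivity
  have p3 : 0 < h * (h ^ 2 + 3 * a ^ 2) ^ 2 := by positivity
  linarith

/-- The squared mixed coefficient over `k₀ ^ 2` is controlled by the cubic bound's left side. -/
lemma cross_term_coefficient_le {l a h r : ℝ} (hl : 0 < l) (hh : 0 < h) (hr : h ≤ r)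
    (hal : a ^ 2 ≤ l ^ 2) :
    16 * a ^ 2 * (r - h) * (r - l ^ 2 / h) ^ 2 / ((1 + r ^ 2 / l ^ 2) ^ 2 * l ^ 4) ≤
      16 * a ^ 2 * r * (l ^ 2 + l ^ 4 / h ^ 2) / ((r ^ 2 + a ^ 2) * l ^ 2) := by
  have hr0 : 0 < r := hh.trans_le hr
  have hk : (1 + r ^ 2 / l ^ 2) ^ 2 * l ^ 4 = (r ^ 2 + l ^ 2) ^ 2 := by
    field_simp
    ring
  have hsq : (r - l ^ 2 / h) ^ 2 ≤ (r ^ 2 + l ^ 2) * (1 + l ^ 2 / h ^ 2) := by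
    have h1 : (r ^ 2 + l ^ 2) * (1 + l ^ 2 / h ^ 2) - (r - l ^ 2 / h) ^ 2 =
        l ^ 2 + r ^ 2 * l ^ 2 / h ^ 2 + 2 * r * l ^ 2 / h := by
      field_simp
      ring
    have h2 : 0 < l ^ 2 + r ^ 2 * l ^ 2 / h ^ 2 + 2 * r * l ^ 2 / h := by positivity
    linarith
  calc 16 * a ^ 2 * (r - h) * (r - l ^ 2 / h) ^ 2 / ((1 + r ^ 2 / l ^ 2) ^ 2 * l ^ 4)
      ≤ 16 * a ^ 2 * r * ((r ^ 2 + l ^ 2) * (1 + l ^ 2 / h ^ 2)) / (r ^ 2 + l ^ 2) ^ 2 := by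
        rw [hk]
        gcongr
        linarith
    _ = 16 * a ^ 2 * r * (l ^ 2 + l ^ 4 / h ^ 2) / ((r ^ 2 + l ^ 2) * l ^ 2) := by
        field_simp
    _ ≤ 16 * a ^ 2 * r * (l ^ 2 + l ^ 4 / h ^ 2) / ((r ^ 2 + a ^ 2) * l ^ 2) := by
        gcongr


/-- Corollary 5.3: for slowly rotating Kerr-AdS there is `a₀ > 0` depending only on
`M` and `l` such that for all `0 < a < a₀`, all horizon radii `r_h` with
`Δ₋(r_h) = 0` and `a·l < r_h²`, all `r ≥ r_h` and `θ ∈ [0, π]`,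
`16·Δ_θ·sin²θ·a²(r − r_h)²(r − l²/r_h)²/(k₀² l⁴) ≤ f(r)`. -/
theorem kerr_ads_cross_term_absorption (M l : ℝ) (hM : 0 < M) (hl : 0 < l) :
    ∃ a₀ : ℝ, 0 < a₀ ∧
      ∀ a : ℝ, 0 < a → a < a₀ →
        ∀ r_h : ℝ, 0 < r_h →
          (r_h ^ 2 + a ^ 2) * (1 + r_h ^ 2 / l ^ 2) - 2 * M * r_h = 0 →
          a * l < r_h ^ 2 →
          ∀ r : ℝ, r_h ≤ r → ∀ θ : ℝ, θ ∈ Set.Icc (0 : ℝ) Real.pi →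
            16 * (1 - (a ^ 2 / l ^ 2) * Real.cos θ ^ 2) * Real.sin θ ^ 2 *
                a ^ 2 * (r - r_h) ^ 2 * (r - l ^ 2 / r_h) ^ 2 /
                ((1 + r ^ 2 / l ^ 2) ^ 2 * l ^ 4) ≤
              (1 / ((r ^ 2 + a ^ 2) * l ^ 2)) * (r - r_h) *
                (r ^ 3 * (l ^ 2 - 4 * a ^ 2) +
                  r ^ 2 * (r_h ^ 3 - a ^ 2 * l ^ 2 / r_h + a ^ 2 * r_h) +
                  r * (r_h ^ 4 - 8 * a ^ 4 + a ^ 2 * (r_h ^ 2 + l ^ 2)) +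
                  r_h * (r_h ^ 2 + 3 * a ^ 2) ^ 2 - a ^ 4 * l ^ 2 / r_h) := by
  have hc : 0 < min l (M / 2) := lt_min hl (by positivity)
  have hcl : min l (M / 2) ≤ l := min_le_left _ _
  refine ⟨min l (M / 2) ^ 2 / (8 * l), by positivity, ?_⟩
  intro a ha ha₀ h hh hΔ hal r hr θ _
  have hch := min_le_horizon_radius hl ha hh hΔ hal
  set c := min l (M / 2)
  rw [lt_div_iff₀ (by positivity)] at ha₀
  have hac : a ≤ c / 8 := by nlinarith
  have hahl : a * l ≤ h ^ 2 / 8 := by nlinarith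
  have hP := cross_term_le_cubic hl ha hh hr (by linarith) (by linarith) hahl
  have hK := cross_term_coefficient_le (a := a) hl hh hr (by gcongr; linarith)
  have hr0 : 0 < r := hh.trans_le hr
  have hrh : 0 ≤ r - h := sub_nonneg.2 hr
  have hang : (1 - (a ^ 2 / l ^ 2) * Real.cos θ ^ 2) * Real.sin θ ^ 2 ≤ 1 := by
    have hx : 0 ≤ a ^ 2 / l ^ 2 * Real.cos θ ^ 2 := by positivity
    nlinarith [sq_nonneg (Real.sin θ), Real.sin_sq_le_one θ]
  set D := (1 - (a ^ 2 / l ^ 2) * Real.cos θ ^ 2) * Real.sin θ ^ 2 with hD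
  set X := 16 * a ^ 2 * (r - h) * (r - l ^ 2 / h) ^ 2 / ((1 + r ^ 2 / l ^ 2) ^ 2 * l ^ 4) with hX
  have hX0 : 0 ≤ X := by positivity
  have hXP := hK.trans (div_le_div_of_nonneg_right hP (by positivity))
  calc _ = D * (X * (r - h)) := by rw [hD, hX]; ring
    _ ≤ 1 * (X * (r - h)) := by gcongr
    _ = X * (r - h) := one_mul _
    _ ≤ _ := mul_le_mul_of_nonneg_right hXP hrh
    _ = _ := by ring
end

section
/- Let M be real, l > 0, a real, θ real, and let r_h > 0 satisfy (r_h² + a²)(1 + r_h²/l²) − 2Mr_h = 0. Set Ξ = 1 − a²/l², k₀ = 1 + r²/l², and Σ = r² + a²cos²θ. Then for every real r with Σ ≠ 0: (aΞ)/Σ − (2Mr)/(k₀Σ) · (aΞ)/(r_h² + a²) = (aΞ)/(k₀Σ) · ((r − r_h)/l²) · (r − l²/r_h). -/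
/-- Identity (5.9): with `Ξ = 1 − a²/l²`, `k₀ = 1 + r²/l²`, `Σ = r² + a²cos²θ` and
`r_h > 0` a root of `Δ₋`, the coefficient of the `(∂_r ψ)(∂_φ ψ)` cross term in the
`K`-energy degenerates linearly at the horizon:
`aΞ/Σ − (2Mr/(k₀Σ))·aΞ/(r_h² + a²) = (aΞ/(k₀Σ))·((r − r_h)/l²)·(r − l²/r_h)`. -/
theorem kerr_ads_cross_term_identity (M a l θ r_h : ℝ) (hl : 0 < l)
    (hrh : 0 < r_h)
    (hroot : (r_h ^ 2 + a ^ 2) * (1 + r_h ^ 2 / l ^ 2) - 2 * M * r_h = 0) :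
    ∀ r : ℝ, r ^ 2 + a ^ 2 * Real.cos θ ^ 2 ≠ 0 →
      (a * (1 - a ^ 2 / l ^ 2)) / (r ^ 2 + a ^ 2 * Real.cos θ ^ 2) -
          (2 * M * r) / ((1 + r ^ 2 / l ^ 2) * (r ^ 2 + a ^ 2 * Real.cos θ ^ 2)) *
            ((a * (1 - a ^ 2 / l ^ 2)) / (r_h ^ 2 + a ^ 2)) =
        (a * (1 - a ^ 2 / l ^ 2)) /
            ((1 + r ^ 2 / l ^ 2) * (r ^ 2 + a ^ 2 * Real.cos θ ^ 2)) *
          ((r - r_h) / l ^ 2) * (r - l ^ 2 / r_h) := by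
  intro r hS
  have hl' : l ≠ 0 := hl.ne'
  have hrh' : r_h ≠ 0 := hrh.ne'
  have hsum : r_h ^ 2 + a ^ 2 ≠ 0 := by positivity
  have hk : 1 + r ^ 2 / l ^ 2 ≠ 0 := by positivity
  generalize r ^ 2 + a ^ 2 * Real.cos θ ^ 2 = S at hS ⊢
  generalize a * (1 - a ^ 2 / l ^ 2) = A
  have hmass : 2 * M / (r_h ^ 2 + a ^ 2) = (1 + r_h ^ 2 / l ^ 2) / r_h := by
    rw [div_eq_div_iff hsum hrh']
    linarith
  have hfactor : 1 + r ^ 2 / l ^ 2 - r * ((1 + r_h ^ 2 / l ^ 2) / r_h) =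
      (r - r_h) / l ^ 2 * (r - l ^ 2 / r_h) := by
    field_simp
    ring
  rw [mul_assoc (A / _), ← hfactor, ← hmass]
  generalize 1 + r ^ 2 / l ^ 2 = k at hk ⊢
  field_simp
end

section
/- Let r_h > 0 and a ∈ ℝ, and let ψ : [r_h, ∞) → ℝ be continuously differentiable. Assume there exists δ > 0 with lim_{r→∞} r^(3/2+δ) ψ(r) = 0, and that ∫_{r_h}^∞ ((r³ − r_h³ + 3a²(r − r_h))²/(r² + a²)) (ψ'(r))² dr < ∞. Then ∫_{r_h}^∞ (r² + a²) ψ(r)² dr ≤ (4/9) ∫_{r_h}^∞ ((r³ − r_h³ + 3a²(r − r_h))²/(r² + a²)) (ψ'(r))² dr. -/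
open MeasureTheory Set Filter

/-- The derivative of `P ψ²`, with `P r = r³ − r_h³ + 3a²(r − r_h)`. -/
lemma hasDerivAt_cubic_mul_sq {ψ : ℝ → ℝ} {d r : ℝ} (r_h a : ℝ) (h : HasDerivAt ψ d r) :
    HasDerivAt (fun r => (r ^ 3 - r_h ^ 3 + 3 * a ^ 2 * (r - r_h)) * ψ r ^ 2)
      (3 * (r ^ 2 + a ^ 2) * ψ r ^ 2 +
        (r ^ 3 - r_h ^ 3 + 3 * a ^ 2 * (r - r_h)) * (2 * ψ r * d)) r := by
  have hP : HasDerivAt (fun r : ℝ => r ^ 3 - r_h ^ 3 + 3 * a ^ 2 * (r - r_h))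
      (3 * (r ^ 2 + a ^ 2)) r := by
    refine (((hasDerivAt_pow 3 r).sub_const (r_h ^ 3)).add
      (((hasDerivAt_id r).sub_const r_h).const_mul (3 * a ^ 2))).congr_deriv ?_
    norm_num
    ring
  refine (hP.mul (h.pow 2)).congr_deriv ?_
  simp

/-- Completing the square: with `D = 3wx² + 2pxy` one has `wx² ≤ (2/3) D + (4/9) p²y²/w`. -/
lemma mul_sq_le_of_pos {w : ℝ} (hw : 0 < w) (p x y : ℝ) :
    w * x ^ 2 ≤ 2 / 3 * (3 * w * x ^ 2 + p * (2 * x * y)) + 4 / 9 * (p ^ 2 / w * y ^ 2) := by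
  have key : 2 / 3 * (3 * w * x ^ 2 + p * (2 * x * y)) + 4 / 9 * (p ^ 2 / w * y ^ 2) - w * x ^ 2
      = (w * x + 2 / 3 * p * y) ^ 2 / w := by
    field_simp
    ring
  have : 0 ≤ (w * x + 2 / 3 * p * y) ^ 2 / w := by positivity
  linarith

/-- The boundary term at infinity vanishes for `ψ = o(r^(−3/2−δ))`. -/
lemma tendsto_cubic_mul_sq_zero {r_h δ : ℝ} (a : ℝ) (hrh : 0 < r_h) (hδ : 0 < δ) {ψ : ℝ → ℝ}
    (h : Tendsto (fun r : ℝ => r ^ ((3 : ℝ) / 2 + δ) * ψ r) atTop (nhds 0)) :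
    Tendsto (fun r => (r ^ 3 - r_h ^ 3 + 3 * a ^ 2 * (r - r_h)) * ψ r ^ 2) atTop (nhds 0) := by
  have hlim : Tendsto (fun r : ℝ => (1 + 3 * a ^ 2) * (r ^ ((3 : ℝ) / 2 + δ) * ψ r) ^ 2)
      atTop (nhds 0) := by
    simpa using (h.pow 2).const_mul (1 + 3 * a ^ 2)
  refine squeeze_zero' ?_ ?_ hlim
  · filter_upwards [eventually_ge_atTop r_h] with r hr
    have h3 : r_h ^ 3 ≤ r ^ 3 := by gcongr
    have : 0 ≤ 3 * a ^ 2 * (r - r_h) := mul_nonneg (by positivity) (by linarith)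
    exact mul_nonneg (by linarith) (sq_nonneg _)
  · filter_upwards [eventually_ge_atTop 1] with r hr
    have hr0 : 0 < r := by linarith
    have hpow : r ^ 3 ≤ (r ^ ((3 : ℝ) / 2 + δ)) ^ 2 := by
      rw [← Real.rpow_natCast, ← Real.rpow_natCast, ← Real.rpow_mul hr0.le]
      apply Real.rpow_le_rpow_of_exponent_le hr
      push_cast
      linarith
    have hle : r ^ 3 - r_h ^ 3 + 3 * a ^ 2 * (r - r_h) ≤ (1 + 3 * a ^ 2) * r ^ 3 := by
      have h1 : r - r_h ≤ r ^ 3 := by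
        linarith [le_self_pow₀ hr (show 3 ≠ 0 by norm_num)]
      have h2 : 3 * a ^ 2 * (r - r_h) ≤ 3 * a ^ 2 * r ^ 3 := by gcongr
      have h3 : 0 < r_h ^ 3 := by positivity
      linarith
    calc (r ^ 3 - r_h ^ 3 + 3 * a ^ 2 * (r - r_h)) * ψ r ^ 2
        ≤ (1 + 3 * a ^ 2) * (r ^ ((3 : ℝ) / 2 + δ)) ^ 2 * ψ r ^ 2 := by
          gcongr
          exact hle.trans (by gcongr)
      _ = _ := by ring

/-- The Hardy inequality on a bounded interval, with its boundary term. -/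
lemma intervalIntegral_hardy_le {r_h R : ℝ} (a : ℝ) (hrh : 0 < r_h) (hR : r_h ≤ R)
    {ψ ψ' : ℝ → ℝ} (hderiv : ∀ r ∈ Icc r_h R, HasDerivAt ψ (ψ' r) r)
    (hcont : ContinuousOn ψ' (Icc r_h R)) :
    ∫ r in r_h..R, (r ^ 2 + a ^ 2) * ψ r ^ 2 ≤
      2 / 3 * ((R ^ 3 - r_h ^ 3 + 3 * a ^ 2 * (R - r_h)) * ψ R ^ 2) +
      4 / 9 * ∫ r in r_h..R, (r ^ 3 - r_h ^ 3 + 3 * a ^ 2 * (r - r_h)) ^ 2 / (r ^ 2 + a ^ 2) *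
        ψ' r ^ 2 := by
  have hw : ∀ r ∈ Icc r_h R, 0 < r ^ 2 + a ^ 2 := fun r hr => by
    have : 0 < r := hrh.trans_le hr.1
    positivity
  have hψ : ContinuousOn ψ (Icc r_h R) := fun r hr => (hderiv r hr).continuousAt.continuousWithinAt
  have hD : IntervalIntegrable (fun r => 3 * (r ^ 2 + a ^ 2) * ψ r ^ 2 +
      (r ^ 3 - r_h ^ 3 + 3 * a ^ 2 * (r - r_h)) * (2 * ψ r * ψ' r)) volume r_h R :=
    ContinuousOn.intervalIntegrable_of_Icc hR (by fun_prop)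
  have hH : IntervalIntegrable (fun r => (r ^ 3 - r_h ^ 3 + 3 * a ^ 2 * (r - r_h)) ^ 2 /
      (r ^ 2 + a ^ 2) * ψ' r ^ 2) volume r_h R :=
    ContinuousOn.intervalIntegrable_of_Icc hR
      ((ContinuousOn.div (by fun_prop) (by fun_prop) fun r hr => (hw r hr).ne').mul (hcont.pow 2))
  have hFTC := intervalIntegral.integral_eq_sub_of_hasDerivAt
    (fun r hr => hasDerivAt_cubic_mul_sq r_h a (hderiv r (by rwa [uIcc_of_le hR] at hr))) hD
  have hmono := intervalIntegral.integral_mono_on hR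
    (ContinuousOn.intervalIntegrable_of_Icc hR (by fun_prop))
    ((hD.const_mul (2 / 3)).add (hH.const_mul (4 / 9)))
    (fun r hr => mul_sq_le_of_pos (hw r hr) (r ^ 3 - r_h ^ 3 + 3 * a ^ 2 * (r - r_h)) (ψ r) (ψ' r))
  rw [intervalIntegral.integral_add (hD.const_mul _) (hH.const_mul _),
    intervalIntegral.integral_const_mul, intervalIntegral.integral_const_mul, hFTC] at hmono
  simpa using hmono

/-- Radial Hardy inequality on Kerr-AdS: if `ψ` is `C¹` on `[r_h, ∞)` and decays like
`r^(−3/2−δ)` at infinity, then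
`∫_{r_h}^∞ (r² + a²)ψ² dr ≤ (4/9) ∫_{r_h}^∞ ((r³ − r_h³ + 3a²(r − r_h))²/(r² + a²)) (ψ')² dr`. -/
theorem hardy_inequality_kerr_ads (r_h a : ℝ) (hrh : 0 < r_h) (ψ ψ' : ℝ → ℝ)
    (hderiv : ∀ r ∈ Ici r_h, HasDerivAt ψ (ψ' r) r)
    (hcont : ContinuousOn ψ' (Ici r_h))
    (hdec : ∃ δ : ℝ, 0 < δ ∧
      Tendsto (fun r : ℝ => r ^ ((3 : ℝ) / 2 + δ) * ψ r) atTop (nhds 0))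
    (hint : IntegrableOn
      (fun r => (r ^ 3 - r_h ^ 3 + 3 * a ^ 2 * (r - r_h)) ^ 2 / (r ^ 2 + a ^ 2) *
        (ψ' r) ^ 2) (Ioi r_h)) :
    ∫ r in Ioi r_h, (r ^ 2 + a ^ 2) * (ψ r) ^ 2 ≤
      (4 / 9) * ∫ r in Ioi r_h,
        (r ^ 3 - r_h ^ 3 + 3 * a ^ 2 * (r - r_h)) ^ 2 / (r ^ 2 + a ^ 2) *
          (ψ' r) ^ 2 := by
  obtain ⟨δ, hδ, hdec⟩ := hdec
  by_cases hL : IntegrableOn (fun r => (r ^ 2 + a ^ 2) * ψ r ^ 2) (Ioi r_h)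
  · have hlim := ((tendsto_cubic_mul_sq_zero a hrh hδ hdec).const_mul (2 / 3)).add
      ((intervalIntegral_tendsto_integral_Ioi r_h hint tendsto_id).const_mul (4 / 9))
    rw [mul_zero, zero_add] at hlim
    refine le_of_tendsto_of_tendsto
      (intervalIntegral_tendsto_integral_Ioi r_h hL tendsto_id) hlim ?_
    filter_upwards [eventually_ge_atTop r_h] with R hR
    exact intervalIntegral_hardy_le a hrh hR (fun r hr => hderiv r hr.1)
      (hcont.mono Icc_subset_Ici_self)
  · rw [integral_undef hL]
    exact mul_nonneg (by norm_num) (integral_nonneg fun r => by positivity)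
end

section
/- Let M > 0 and l > 0. There exists a₀ > 0, depending only on M and l, such that for every a with 0 < a < a₀ and every r_h > 0 satisfying Δ₋(r_h) = 0 and a·l < r_h², the following holds for all r ≥ r_h and all θ ∈ (0, π): Ξ²/(4 Δ_θ Σ sin²θ) − 2a²Ξ²/((r_h² + a²) k₀ l² Δ_θ) ≥ 0, where Ξ = 1 − a²/l², k₀ = 1 + r²/l², Δ_θ = 1 − (a²/l²)cos²θ, and Σ = r² + a²cos²θ. -/
/-- Condition (5.4): for slowly rotating Kerr-AdS there is `a₀ > 0` depending only on
`M` and `l` such that for all `0 < a < a₀`, all horizon radii `r_h` with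
`Δ₋(r_h) = 0` and `a·l < r_h²`, all `r ≥ r_h` and `θ ∈ (0, π)`,
`Ξ²/(4Δ_θΣ sin²θ) − 2a²Ξ²/((r_h² + a²)k₀l²Δ_θ) ≥ 0`. -/
theorem kerr_ads_phi_coefficient_nonneg (M l : ℝ) (hM : 0 < M) (hl : 0 < l) :
    ∃ a₀ : ℝ, 0 < a₀ ∧
      ∀ a : ℝ, 0 < a → a < a₀ →
        ∀ r_h : ℝ, 0 < r_h →
          (r_h ^ 2 + a ^ 2) * (1 + r_h ^ 2 / l ^ 2) - 2 * M * r_h = 0 →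
          a * l < r_h ^ 2 →
          ∀ r : ℝ, r_h ≤ r → ∀ θ : ℝ, θ ∈ Set.Ioo (0 : ℝ) Real.pi →
            0 ≤ (1 - a ^ 2 / l ^ 2) ^ 2 /
                  (4 * (1 - (a ^ 2 / l ^ 2) * Real.cos θ ^ 2) *
                    (r ^ 2 + a ^ 2 * Real.cos θ ^ 2) * Real.sin θ ^ 2) -
                2 * a ^ 2 * (1 - a ^ 2 / l ^ 2) ^ 2 /
                  ((r_h ^ 2 + a ^ 2) * (1 + r ^ 2 / l ^ 2) * l ^ 2 *
                    (1 - (a ^ 2 / l ^ 2) * Real.cos θ ^ 2)) := by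
  refine ⟨l / 8, by positivity, ?_⟩
  intro a ha ha8 r_h hr_h _ hal r hr θ hθ
  have hs : 0 < Real.sin θ := Real.sin_pos_of_mem_Ioo hθ
  have hs1 : Real.sin θ ^ 2 ≤ 1 := Real.sin_sq_le_one θ
  have hc1 : Real.cos θ ^ 2 ≤ 1 := Real.cos_sq_le_one θ
  have hr0 : 0 < r := hr_h.trans_le hr
  have hal2 : a ^ 2 < l ^ 2 := by nlinarith
  have hΔ : 0 < 1 - (a ^ 2 / l ^ 2) * Real.cos θ ^ 2 := by
    have h1 : a ^ 2 / l ^ 2 < 1 := (div_lt_one (by positivity)).2 hal2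
    have h0 : 0 ≤ a ^ 2 / l ^ 2 := by positivity
    nlinarith
  have hk : (1 + r ^ 2 / l ^ 2) * l ^ 2 = l ^ 2 + r ^ 2 := by field_simp
  have hsig : (r ^ 2 + a ^ 2 * Real.cos θ ^ 2) * Real.sin θ ^ 2 ≤ l ^ 2 + r ^ 2 := by
    calc (r ^ 2 + a ^ 2 * Real.cos θ ^ 2) * Real.sin θ ^ 2
        ≤ r ^ 2 + a ^ 2 * Real.cos θ ^ 2 := mul_le_of_le_one_right (by positivity) hs1
      _ ≤ l ^ 2 + r ^ 2 := by nlinarith [mul_le_of_le_one_right (sq_nonneg a) hc1]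
  have hh : 8 * a ^ 2 ≤ r_h ^ 2 + a ^ 2 := by nlinarith
  have key : 8 * a ^ 2 * ((r ^ 2 + a ^ 2 * Real.cos θ ^ 2) * Real.sin θ ^ 2) ≤
      (r_h ^ 2 + a ^ 2) * (l ^ 2 + r ^ 2) :=
    mul_le_mul hh hsig (by positivity) (by positivity)
  rw [mul_assoc (r_h ^ 2 + a ^ 2), hk, sub_nonneg, div_le_div_iff₀ (by positivity) (by positivity)]
  have hfac : 0 ≤ (1 - a ^ 2 / l ^ 2) ^ 2 * (1 - (a ^ 2 / l ^ 2) * Real.cos θ ^ 2) :=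
    mul_nonneg (sq_nonneg _) hΔ.le
  linear_combination mul_le_mul_of_nonneg_left key hfac
end
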